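/- Let κ be an infinite cardinal. If a graph G admits a componental rooted tree-decomposition of width < κ, then G admits a rooted tree-decomposition of width < κ that is both tight and componental; concretely, given a componental rooted tree-decomposition (T, (V_t)) of G, deleting for every edge e of T from every bag V_t with t ∈ T_e all vertices of V_e that have no neighbour in G∘↑e yields a tight and componental rooted tree-decomposition of G whose bags are subsets of the original bags. -/

import Mathlib

open SimpleGraph

universe u v

section CommonDefs

variable {V : Type u} {N : Type v}

/-- `u` and `w` are joined by a walk in `G` all of whose vertices avoid `X`,
i.e. they lie in the same component of `G - X`. -/
def ConnAvoiding (G : SimpleGraph V) (X : Set V) (u w : V) : Prop :=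
  ∃ p : G.Walk u w, ∀ x ∈ p.support, x ∉ X

/-- `r` is a (one-way infinite) ray in `G`. -/
def IsRay (G : SimpleGraph V) (r : ℕ → V) : Prop :=
  Function.Injective r ∧ ∀ n : ℕ, G.Adj (r n) (r (n + 1))

/-- Two rays are equivalent (i.e. belong to the same end) if for every finite vertex set `X`
they have tails in the same component of `G - X`. -/
def RayEquiv (G : SimpleGraph V) (r r' : ℕ → V) : Prop :=
  ∀ X : Set V, X.Finite → ∃ M : ℕ, ∀ m ≥ M, ∀ n ≥ M, ConnAvoiding G X (r m) (r' n)

/-- `v` lies in the component `C_G(X, ε)` of `G - X` containing a tail of the ray `r`. -/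
def InEndComp (G : SimpleGraph V) (X : Set V) (r : ℕ → V) (v : V) : Prop :=
  ∃ M : ℕ, ∀ n ≥ M, ConnAvoiding G X v (r n)

/-- `v` dominates the end of the ray `r`. -/
def Dominates (G : SimpleGraph V) (r : ℕ → V) (v : V) : Prop :=
  ∀ X : Set V, X.Finite → v ∉ X → InEndComp G X r v

/-- `Dom(ε)` for the end `ε` of the ray `r`. -/
def DomSet (G : SimpleGraph V) (r : ℕ → V) : Set V := {v | Dominates G r v}

/-- There are `n` pairwise (vertex-)disjoint rays belonging to the end of `r`. -/
def HasDisjRays (G : SimpleGraph V) (r : ℕ → V) (n : ℕ) : Prop :=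
  ∃ f : Fin n → ℕ → V, (∀ i, IsRay G (f i)) ∧ (∀ i, RayEquiv G r (f i)) ∧
    Pairwise fun i j => ∀ k l : ℕ, f i k ≠ f j l

/-- The degree of the end of `r`, as an extended natural number. -/
noncomputable def EndDegree (G : SimpleGraph V) (r : ℕ → V) : ℕ∞ :=
  ⨆ (n : ℕ) (_ : HasDisjRays G r n), (n : ℕ∞)

/-- A family of pairwise disjoint `A`–`B` paths indexed by `ι`. -/
def DisjointPathsFam (G : SimpleGraph V) (A B : Set V) (ι : Type*) : Prop :=
  ∃ (a b : ι → V) (p : ∀ i : ι, G.Walk (a i) (b i)),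
    (∀ i, (p i).IsPath) ∧ (∀ i, a i ∈ A) ∧ (∀ i, b i ∈ B) ∧
    Pairwise fun i j => ∀ x ∈ (p i).support, x ∉ (p j).support

/-- There are `n` pairwise disjoint `A`–`B` paths in `G`. -/
def DisjointPaths (G : SimpleGraph V) (A B : Set V) (n : ℕ) : Prop :=
  DisjointPathsFam G A B (Fin n)

/-- `C` is (the vertex set of) a connected component of the subgraph of `G` induced on `S`. -/
def IsCompOf (G : SimpleGraph V) (S C : Set V) : Prop :=
  C.Nonempty ∧ C ⊆ S ∧ (G.induce C).Connected ∧
    ∀ u ∈ C, ∀ v ∈ S, G.Adj u v → v ∈ C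

/-- The neighbourhood `N_G(C)` of the set `C` in `G`. -/
def NbhdSet (G : SimpleGraph V) (C : Set V) : Set V :=
  {v | v ∉ C ∧ ∃ u ∈ C, G.Adj u v}

/-- A graph is locally finite if every vertex has finite degree. -/
def LocFin (G : SimpleGraph V) : Prop := ∀ v : V, {w : V | G.Adj v w}.Finite

/-- A tree-decomposition of `G` with decomposition tree `T`. -/
structure TreeDecomp (G : SimpleGraph V) (T : SimpleGraph N) : Type (max u v) where
  isTree : T.IsTree
  bag : N → Set V
  bag_cover : ∀ v : V, ∃ t : N, v ∈ bag t
  bag_edge : ∀ ⦃x y : V⦄, G.Adj x y → ∃ t : N, x ∈ bag t ∧ y ∈ bag t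
  bag_conn : ∀ (v : V) {s t : N} (p : T.Walk s t), p.IsPath →
    v ∈ bag s → v ∈ bag t → ∀ x ∈ p.support, v ∈ bag x

namespace TreeDecomp

variable {G : SimpleGraph V} {T : SimpleGraph N}

/-- The unique path in the tree `T` from `s` to `t`. -/
noncomputable def path (D : TreeDecomp G T) (s t : N) : T.Walk s t :=
  (D.isTree.existsUnique_path s t).choose

/-- The adhesion set of the edge `ab` of `T`. -/
def adh (D : TreeDecomp G T) (a b : N) : Set V := D.bag a ∩ D.bag b

/-- `ab` is an edge of `T` lying on the path from `s` to `t`. -/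
def EdgeOnPath (D : TreeDecomp G T) (s t a b : N) : Prop :=
  T.Adj a b ∧ s(a, b) ∈ (D.path s t).edges

/-- All bags are finite. -/
def FiniteParts (D : TreeDecomp G T) : Prop := ∀ t : N, (D.bag t).Finite

/-- The tree-decomposition is lean. -/
def IsLean (D : TreeDecomp G T) : Prop :=
  ∀ (s t : N) (Zs Zt : Finset V), ↑Zs ⊆ D.bag s → ↑Zt ⊆ D.bag t →
    Zs.card = Zt.card →
    DisjointPaths G ↑Zs ↑Zt Zs.card ∨
      ∃ a b : N, D.EdgeOnPath s t a b ∧ (D.adh a b).encard < (Zs.card : ℕ∞)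

/-- The tree-decomposition is strongly linked: for all nodes `s ≠ t` there are
`min {|V_e| : e ∈ E(sTt)}` pairwise disjoint `V_s`–`V_t` paths. -/
def StronglyLinked (D : TreeDecomp G T) : Prop :=
  ∀ s t : N, s ≠ t →
    ∃ c : Cardinal.{u},
      (∀ a b : N, D.EdgeOnPath s t a b → c ≤ Cardinal.mk ↥(D.adh a b)) ∧
      (∃ a b : N, D.EdgeOnPath s t a b ∧ c = Cardinal.mk ↥(D.adh a b)) ∧
      ∃ ι : Type u, Cardinal.mk ι = c ∧ DisjointPathsFam G (D.bag s) (D.bag t) ι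

/-- One side of the separation of `G` induced by the edge `ab` of `T`: the union of the
bags over all nodes in the component of `T - ab` containing `a`. -/
def sideSet (D : TreeDecomp G T) (a b : N) : Set V :=
  ⋃ x ∈ {x : N | b ∉ (D.path a x).support}, D.bag x

end TreeDecomp

/-- A rooted tree-decomposition. -/
structure RootedTreeDecomp (G : SimpleGraph V) (T : SimpleGraph N)
    extends TreeDecomp G T : Type (max u v) where
  root : N

namespace RootedTreeDecomp

variable {G : SimpleGraph V} {T : SimpleGraph N}

/-- The tree-order on `T` induced by the root: `s ≤ t` iff `s` lies on the path
from the root to `t`. -/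
def le (D : RootedTreeDecomp G T) (s t : N) : Prop :=
  s ∈ (D.toTreeDecomp.path D.root t).support

/-- `st` is an edge of `T` with `s < t` in the tree-order. -/
def IsOrientedEdge (D : RootedTreeDecomp G T) (s t : N) : Prop :=
  T.Adj s t ∧ D.le s t

/-- The vertex set of `G↑e` for the oriented edge `e = st`: the union of the bags over
all nodes of the component `T_e` of `T - e` not containing the root. -/
def above (D : RootedTreeDecomp G T) (t : N) : Set V :=
  ⋃ x ∈ {x : N | D.le t x}, D.bag x

/-- The vertex set of `G∘↑e` (the part strictly above `e`) for the oriented edge `e = st`. -/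
def strictAbove (D : RootedTreeDecomp G T) (s t : N) : Set V :=
  D.above t \ (D.bag s ∩ D.bag t)

/-- The rooted tree-decomposition is componental. -/
def Componental (D : RootedTreeDecomp G T) : Prop :=
  ∀ s t : N, D.IsOrientedEdge s t → (G.induce (D.strictAbove s t)).Connected

/-- The rooted tree-decomposition is tight. -/
def Tight (D : RootedTreeDecomp G T) : Prop :=
  ∀ s t : N, D.IsOrientedEdge s t →
    ∃ C : Set V, IsCompOf G (D.strictAbove s t) C ∧ NbhdSet G C = D.bag s ∩ D.bag t

/-- The rooted tree-decomposition is linked: for all comparable nodes `s < t` there are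
`min {|V_e| : e ∈ E(sTt)}` pairwise disjoint `V_s`–`V_t` paths. -/
def Linked (D : RootedTreeDecomp G T) : Prop :=
  ∀ s t : N, D.le s t → s ≠ t →
    ∃ c : Cardinal.{u},
      (∀ a b : N, D.toTreeDecomp.EdgeOnPath s t a b →
        c ≤ Cardinal.mk ↥(D.bag a ∩ D.bag b)) ∧
      (∃ a b : N, D.toTreeDecomp.EdgeOnPath s t a b ∧
        c = Cardinal.mk ↥(D.bag a ∩ D.bag b)) ∧
      ∃ ι : Type u, Cardinal.mk ι = c ∧ DisjointPathsFam G (D.bag s) (D.bag t) ι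

/-- A rooted ray of `T`, i.e. a ray starting at the root. -/
def IsRootedRay (D : RootedTreeDecomp G T) (ρ : ℕ → N) : Prop :=
  IsRay T ρ ∧ ρ 0 = D.root

/-- `liminf_{e ∈ E(R)} V_e`: the vertices lying in `V_e` for all but finitely many
edges `e` of the ray `R = ρ`. -/
def bagLiminf (D : RootedTreeDecomp G T) (ρ : ℕ → N) : Set V :=
  {v | ∃ M : ℕ, ∀ n ≥ M, v ∈ D.bag (ρ n) ∩ D.bag (ρ (n + 1))}

/-- `liminf_{e ∈ E(R)} |V_e|` for the ray `R = ρ`. -/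
noncomputable def adhLiminf (D : RootedTreeDecomp G T) (ρ : ℕ → N) : ℕ∞ :=
  Filter.liminf (fun n : ℕ => (D.bag (ρ n) ∩ D.bag (ρ (n + 1))).encard) Filter.atTop

/-- The end of the ray `r` of `G` gives rise to the rooted ray `ρ` of `T`: every ray
equivalent to `r` meets every bag along `ρ` only finitely often, and for every edge
`e = st` of `ρ` the component `C_G(V_s, ε)` is contained in `G∘↑e`. -/
def GivesRise (D : RootedTreeDecomp G T) (r : ℕ → V) (ρ : ℕ → N) : Prop :=
  D.IsRootedRay ρ ∧
  (∀ r' : ℕ → V, IsRay G r' → RayEquiv G r r' →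
    ∀ n : ℕ, {k : ℕ | r' k ∈ D.bag (ρ n)}.Finite) ∧
  (∀ (n : ℕ) (v : V), InEndComp G (D.bag (ρ n)) r v →
    v ∈ D.strictAbove (ρ n) (ρ (n + 1)))

end RootedTreeDecomp

/-- `{A, B}` is a separation of `G`. -/
def IsSeparation (G : SimpleGraph V) (A B : Set V) : Prop :=
  A ∪ B = Set.univ ∧ ∀ a ∈ A \ B, ∀ b ∈ B \ A, ¬ G.Adj a b

/-- The separation `{A, B}` separates the ends of `r` and `r'`: they live in components of
`G - (A ∩ B)` contained in different sides of `{A, B}`. -/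
def SepSeparatesEnds (G : SimpleGraph V) (A B : Set V) (r r' : ℕ → V) : Prop :=
  ((∀ v, InEndComp G (A ∩ B) r v → v ∈ A \ B) ∧
    (∀ v, InEndComp G (A ∩ B) r' v → v ∈ B \ A)) ∨
  ((∀ v, InEndComp G (A ∩ B) r v → v ∈ B \ A) ∧
    (∀ v, InEndComp G (A ∩ B) r' v → v ∈ A \ B))

/-- The separation `{A, B}` efficiently distinguishes the ends of `r` and `r'`. -/
def EffDistinguishes (G : SimpleGraph V) (A B : Set V) (r r' : ℕ → V) : Prop :=
  IsSeparation G A B ∧ SepSeparatesEnds G A B r r' ∧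
    ∀ A' B' : Set V, IsSeparation G A' B' → SepSeparatesEnds G A' B' r r' →
      (A ∩ B).encard ≤ (A' ∩ B').encard

/-- The tree-decomposition `D` distinguishes the ends of `r` and `r'` efficiently. -/
def TreeDecomp.EffDistinguishesEnds {G : SimpleGraph V} {T : SimpleGraph N}
    (D : TreeDecomp G T) (r r' : ℕ → V) : Prop :=
  ∃ a b : N, T.Adj a b ∧ EffDistinguishes G (D.sideSet a b) (D.sideSet b a) r r'

/-- `G` contains `H` as a minor. -/
def HasMinor {W : Type v} (G : SimpleGraph V) (H : SimpleGraph W) : Prop :=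
  ∃ B : W → Set V, (∀ h, (B h).Nonempty) ∧ (∀ h, (G.induce (B h)).Connected) ∧
    (Pairwise fun h h' => Disjoint (B h) (B h')) ∧
    ∀ ⦃h h'⦄, H.Adj h h' → ∃ u ∈ B h, ∃ w ∈ B h', G.Adj u w

/-- The half-grid: the graph on `ℕ × ℤ` in which `(i, j)` and `(i', j')` are adjacent
iff `|i - i'| + |j - j'| = 1`. -/
def halfGrid : SimpleGraph (ℕ × ℤ) :=
  SimpleGraph.fromRel fun p q =>
    ((p.1 : ℤ) - (q.1 : ℤ)).natAbs + (p.2 - q.2).natAbs = 1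

/-- The one-way infinite path on `ℕ`. -/
def natRayGraph : SimpleGraph ℕ :=
  SimpleGraph.fromRel fun m n => n = m + 1

/-- The path on `m` vertices. -/
def finPathGraph (m : ℕ) : SimpleGraph (Fin m) :=
  SimpleGraph.fromRel fun i j => (j : ℕ) = (i : ℕ) + 1

/-- The strong product of two graphs. -/
def strongProd {W : Type v} (G : SimpleGraph V) (H : SimpleGraph W) : SimpleGraph (V × W) :=
  SimpleGraph.fromRel fun x y =>
    (x.1 = y.1 ∨ G.Adj x.1 y.1) ∧ (x.2 = y.2 ∨ H.Adj x.2 y.2)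

end CommonDefs

namespace TreeDecomp

variable {V : Type u} {N : Type v} {G : SimpleGraph V} {T : SimpleGraph N}

theorem path_isPath (D : TreeDecomp G T) (s t : N) : (D.path s t).IsPath :=
  (D.isTree.existsUnique_path s t).choose_spec.1

theorem eq_path (D : TreeDecomp G T) {s t : N} {p : T.Walk s t} (hp : p.IsPath) :
    p = D.path s t :=
  (D.isTree.existsUnique_path s t).unique hp (D.path_isPath s t)

theorem support_path_subset (D : TreeDecomp G T) {s t : N} (w : T.Walk s t) :
    (D.path s t).support ⊆ w.support := by
  classical
  rw [← D.eq_path w.bypass_isPath]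
  exact w.support_bypass_subset_support

end TreeDecomp

namespace RootedTreeDecomp

variable {V : Type u} {N : Type v} {G : SimpleGraph V} {T : SimpleGraph N}
  (D : RootedTreeDecomp G T) {a b c d m s t : N} {x y : V}

theorem le_refl (t : N) : D.le t t := Walk.end_mem_support _

variable {D}

theorem le_trans (hst : D.le s t) (htm : D.le t m) : D.le s m := by
  classical
  have h := D.eq_path ((D.path_isPath D.root m).takeUntil htm)
  rw [le, ← h] at hst
  exact Walk.support_takeUntil_subset_support _ htm hst

theorem length_path_lt_of_le_of_ne (hst : D.le s t) (hne : s ≠ t) :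
    (D.path D.root s).length < (D.path D.root t).length := by
  classical
  rw [← D.eq_path ((D.path_isPath D.root t).takeUntil hst)]
  exact Walk.length_takeUntil_lt_length hst hne

theorem le_antisymm (hst : D.le s t) (hts : D.le t s) : s = t := by
  by_contra hne
  exact lt_asymm (length_path_lt_of_le_of_ne hst hne)
    (length_path_lt_of_le_of_ne hts (Ne.symm hne))

theorem le_total_of_le (hs : D.le s m) (ht : D.le t m) : D.le s t ∨ D.le t s := by
  classical
  have key : ∀ {s t : N} (ht : t ∈ (D.path D.root m).support),
      s ∈ ((D.path D.root m).dropUntil t ht).support → D.le t s := by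
    intro s t ht h
    have hp : (((D.path D.root m).takeUntil t ht).append
        (((D.path D.root m).dropUntil t ht).takeUntil s h)).IsPath := by
      refine Walk.IsPath.of_append_left
        (q := ((D.path D.root m).dropUntil t ht).dropUntil s h) ?_
      rw [← Walk.append_assoc, Walk.take_spec, Walk.take_spec]
      exact D.path_isPath _ _
    rw [le, ← D.eq_path hp, Walk.mem_support_append_iff]
    exact Or.inl (Walk.end_mem_support _)
  have h := hs
  rw [le, ← Walk.take_spec _ ht, Walk.mem_support_append_iff,
    D.eq_path ((D.path_isPath D.root m).takeUntil ht)] at h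
  exact h.imp_right (key ht)

theorem mem_support_path_of_le_of_le (hsm : D.le s m) (hmt : D.le m t) :
    m ∈ (D.path s t).support := by
  classical
  have hst := le_trans hsm hmt
  have h := hmt
  rw [le, ← Walk.take_spec _ hst, Walk.mem_support_append_iff,
    D.eq_path ((D.path_isPath D.root t).takeUntil hst),
    D.eq_path ((D.path_isPath D.root t).dropUntil hst)] at h
  rcases h with h | h
  · rw [le_antisymm h hsm]
    exact Walk.start_mem_support _
  · exact h

theorem mem_bag_of_le_of_le (hsm : D.le s m) (hmt : D.le m t) (hs : x ∈ D.bag s)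
    (ht : x ∈ D.bag t) : x ∈ D.bag m :=
  D.bag_conn x _ (D.path_isPath s t) hs ht m (mem_support_path_of_le_of_le hsm hmt)

theorem path_eq_concat (hab : T.Adj a b) (hba : ¬ D.le b a) :
    (D.path D.root a).concat hab = D.path D.root b :=
  D.eq_path ((D.path_isPath _ _).concat hba hab)

theorem le_or_le_of_adj (hab : T.Adj a b) : D.le a b ∨ D.le b a := by
  by_cases hba : D.le b a
  · exact Or.inr hba
  · left
    rw [le, ← path_eq_concat hab hba, Walk.support_concat]
    simp

theorem IsOrientedEdge.not_le (h : D.IsOrientedEdge a b) : ¬ D.le b a :=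
  fun hba => h.1.ne (le_antisymm h.2 hba)

theorem IsOrientedEdge.le_of_le_of_ne (h : D.IsOrientedEdge a b) (hm : D.le m b)
    (hne : m ≠ b) : D.le m a := by
  rw [le, ← path_eq_concat h.1 h.not_le, Walk.support_concat] at hm
  rw [le]
  simpa [hne] using hm

variable (D) in
theorem exists_least_mem_bag (x : V) :
    ∃ m, x ∈ D.bag m ∧ ∀ t, x ∈ D.bag t → D.le m t := by
  obtain ⟨m, hm, hmin⟩ := WellFounded.has_min
    (InvImage.wf (fun t => (D.path D.root t).length) Nat.lt_wfRel.wf)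
    {t | x ∈ D.bag t} (D.bag_cover x)
  refine ⟨m, hm, fun t ht => ?_⟩
  have key : ∀ {s t : N} (p : T.Walk s t), (∀ y ∈ p.support, x ∈ D.bag y) →
      D.le m s → D.le m t := by
    intro s t p
    induction p with
    | nil => exact fun _ h => h
    | cons hadj p ih =>
      intro hp hs
      refine ih (fun y hy => hp y (by simp [hy])) ?_
      rcases le_or_le_of_adj (D := D) hadj with h | h
      · exact le_trans hs h
      · rcases le_total_of_le hs h with h' | h'
        · exact h'
        · by_contra hne
          refine hmin _ (hp _ ?_) (length_path_lt_of_le_of_ne h' ?_)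
          · simp
          · rintro rfl
            exact hne h'
  exact key (D.path m t) (D.bag_conn x _ (D.path_isPath m t) hm ht) (D.le_refl m)

theorem IsOrientedEdge.mem_inter_of_mem_bag (h : D.IsOrientedEdge a b) (hbt : D.le b t)
    (hbc : ¬ D.le b c) (ht : x ∈ D.bag t) (hc : x ∈ D.bag c) : x ∈ D.bag a ∩ D.bag b := by
  obtain ⟨m, hm, hmin⟩ := D.exists_least_mem_bag x
  have hmb : D.le m b := by
    refine (le_total_of_le (hmin t ht) hbt).resolve_right fun hbm => ?_
    exact hbc (le_trans hbm (hmin c hc))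
  have hne : m ≠ b := by
    rintro rfl
    exact hbc (hmin c hc)
  exact ⟨mem_bag_of_le_of_le (h.le_of_le_of_ne hmb hne) (le_trans h.2 hbt) hm ht,
    mem_bag_of_le_of_le hmb hbt hm ht⟩

theorem mem_above : x ∈ D.above b ↔ ∃ t, D.le b t ∧ x ∈ D.bag t := by
  simp [above]

theorem IsOrientedEdge.le_of_mem_strictAbove (h : D.IsOrientedEdge a b)
    (hx : x ∈ D.strictAbove a b) (ht : x ∈ D.bag t) : D.le b t := by
  obtain ⟨s, hbs, hs⟩ := mem_above.1 hx.1
  by_contra hbt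
  exact hx.2 (h.mem_inter_of_mem_bag hbs hbt hs ht)

theorem IsOrientedEdge.strictAbove_subset (h : D.IsOrientedEdge a b)
    (h' : D.IsOrientedEdge c d) (hdb : D.le d b) :
    D.strictAbove a b ⊆ D.strictAbove c d := by
  intro x hx
  obtain ⟨s, hbs, hs⟩ := mem_above.1 hx.1
  refine ⟨mem_above.2 ⟨s, le_trans hdb hbs, hs⟩, fun hcd => ?_⟩
  exact h'.not_le (le_trans hdb (h.le_of_mem_strictAbove hx hcd.1))

theorem IsOrientedEdge.mem_inter_of_adj (h : D.IsOrientedEdge a b)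
    (hx : x ∈ D.strictAbove a b) (hxy : G.Adj x y) (hy : y ∉ D.strictAbove a b) :
    y ∈ D.bag a ∩ D.bag b := by
  obtain ⟨t, hxt, hyt⟩ := D.bag_edge hxy
  by_contra hab
  exact hy ⟨mem_above.2 ⟨t, h.le_of_mem_strictAbove hx hxt, hyt⟩, hab⟩

variable (D) in
/-- The vertices deleted from the bag at `t`: those which, for some edge `e` below `t`, lie in
the adhesion set of `e` but have no neighbour strictly above `e`. -/
def loose (t : N) : Set V :=
  {x | ∃ a b, D.IsOrientedEdge a b ∧ D.le b t ∧
    x ∈ D.bag a ∩ D.bag b ∧ ∀ u ∈ D.strictAbove a b, ¬ G.Adj x u}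

theorem loose_mono (hst : D.le s t) : D.loose s ⊆ D.loose t :=
  fun _ ⟨a, b, hab, hbs, h⟩ => ⟨a, b, hab, le_trans hbs hst, h⟩

theorem notMem_loose_of_least (hmin : ∀ t, x ∈ D.bag t → D.le m t) : x ∉ D.loose m :=
  fun ⟨a, _, hab, hbm, hx, _⟩ => hab.not_le (le_trans hbm (hmin a hx.1))

theorem notMem_loose_of_adj (hxy : G.Adj x y) (hy : y ∈ D.bag m)
    (hmin : ∀ t, y ∈ D.bag t → D.le m t) : x ∉ D.loose m :=
  fun ⟨a, _, hab, hbm, _, hx⟩ => hx y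
    ⟨mem_above.2 ⟨m, hbm, hy⟩, fun hya => hab.not_le (le_trans hbm (hmin a hya.1))⟩ hxy

variable (D) in
/-- The rooted tree-decomposition obtained by deleting the loose vertices from each bag. -/
def prune : RootedTreeDecomp G T where
  isTree := D.isTree
  bag t := D.bag t \ D.loose t
  bag_cover x := by
    obtain ⟨m, hm, hmin⟩ := D.exists_least_mem_bag x
    exact ⟨m, hm, notMem_loose_of_least hmin⟩
  bag_edge x y hxy := by
    obtain ⟨t, hxt, hyt⟩ := D.bag_edge hxy
    obtain ⟨m, hm, hmin⟩ := D.exists_least_mem_bag x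
    obtain ⟨n, hn, hnmin⟩ := D.exists_least_mem_bag y
    rcases le_total_of_le (hmin t hxt) (hnmin t hyt) with h | h
    · exact ⟨n, ⟨mem_bag_of_le_of_le h (hnmin t hyt) hm hxt, notMem_loose_of_adj hxy hn hnmin⟩,
        hn, notMem_loose_of_least hnmin⟩
    · exact ⟨m, ⟨hm, notMem_loose_of_least hmin⟩,
        mem_bag_of_le_of_le h (hmin t hxt) hn hyt, notMem_loose_of_adj hxy.symm hm hmin⟩
  bag_conn x s t p hp hs ht y hy := by
    refine ⟨D.bag_conn x p hp hs.1 ht.1 y hy, fun hxy => ?_⟩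
    rw [D.eq_path hp] at hy
    have := D.support_path_subset ((D.path D.root s).reverse.append (D.path D.root t)) hy
    rw [Walk.mem_support_append_iff, Walk.support_reverse, List.mem_reverse] at this
    rcases this with h | h
    · exact hs.2 (loose_mono h hxy)
    · exact ht.2 (loose_mono h hxy)
  root := D.root

theorem isOrientedEdge_prune : D.prune.IsOrientedEdge a b ↔ D.IsOrientedEdge a b := Iff.rfl

theorem mem_prune_above : x ∈ D.prune.above b ↔ ∃ t, D.le b t ∧ x ∈ D.bag t \ D.loose t :=
  mem_above

theorem IsOrientedEdge.strictAbove_prune (h : D.IsOrientedEdge a b) :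
    D.prune.strictAbove a b = D.strictAbove a b := by
  ext x
  constructor
  · rintro ⟨hx, hx'⟩
    obtain ⟨t, hbt, hxt, hl⟩ := mem_prune_above.1 hx
    refine ⟨mem_above.2 ⟨t, hbt, hxt⟩, fun hab => hx' ?_⟩
    exact ⟨⟨hab.1, fun hl' => hl (loose_mono (le_trans h.2 hbt) hl')⟩,
      hab.2, fun hl' => hl (loose_mono hbt hl')⟩
  · intro hx
    obtain ⟨m, hm, hmin⟩ := D.exists_least_mem_bag x
    exact ⟨mem_prune_above.2 ⟨m, h.le_of_mem_strictAbove hx hm, hm, notMem_loose_of_least hmin⟩,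
      fun hab => hx.2 ⟨hab.1.1, hab.2.1⟩⟩

theorem IsOrientedEdge.nbhdSet_strictAbove (h : D.IsOrientedEdge a b) :
    NbhdSet G (D.strictAbove a b) = D.prune.bag a ∩ D.prune.bag b := by
  ext x
  constructor
  · rintro ⟨hx, u, hu, hux⟩
    have hab := h.mem_inter_of_adj hu hux hx
    have hl : x ∉ D.loose b := fun ⟨_, _, hcd, hdb, _, hno⟩ =>
      hno u (h.strictAbove_subset hcd hdb hu) hux.symm
    exact ⟨⟨hab.1, fun hl' => hl (loose_mono h.2 hl')⟩, hab.2, hl⟩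
  · rintro ⟨⟨hxa, -⟩, hxb, hl⟩
    refine ⟨fun hx => hx.2 ⟨hxa, hxb⟩, ?_⟩
    by_contra! hno
    exact hl ⟨a, b, h, D.le_refl b, ⟨hxa, hxb⟩, fun u hu hadj => hno u hu hadj.symm⟩

theorem Componental.prune (hD : D.Componental) : D.prune.Componental := by
  intro a b h
  rw [isOrientedEdge_prune] at h
  rw [h.strictAbove_prune]
  exact hD a b h

theorem Componental.tight_prune (hD : D.Componental) : D.prune.Tight := by
  intro a b h
  rw [isOrientedEdge_prune] at h
  rw [h.strictAbove_prune]
  have hconn := hD a b h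
  exact ⟨D.strictAbove a b,
    ⟨Set.nonempty_coe_sort.1 hconn.nonempty, subset_rfl, hconn, fun _ _ _ hv _ => hv⟩,
    h.nbhdSet_strictAbove⟩

end RootedTreeDecomp

/-- Let `κ` be an infinite cardinal. If `G` admits a componental rooted
tree-decomposition of width `< κ`, then `G` admits a tight and componental rooted
tree-decomposition of width `< κ`: deleting, for every edge `e` of `T`, from every bag
`V_t` with `t ∈ T_e` all vertices of `V_e` having no neighbour in `G∘↑e` yields a tight
and componental rooted tree-decomposition whose bags are subsets of the original bags. -/
theorem statement_19 {V : Type u} {M : Type v} (κ : Cardinal.{u})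
    (hκ : Cardinal.aleph0 ≤ κ)
    (G : SimpleGraph V) (T : SimpleGraph M) (D : RootedTreeDecomp G T)
    (hw : ∀ t : M, Cardinal.mk ↥(D.bag t) < κ) (hcomp : D.Componental) :
    ∃ D' : RootedTreeDecomp G T, D'.root = D.root ∧
      (∀ t : M, D'.bag t = D.bag t \
        {x : V | ∃ a b : M, D.IsOrientedEdge a b ∧ D.le b t ∧
          x ∈ D.bag a ∩ D.bag b ∧ ∀ u ∈ D.strictAbove a b, ¬ G.Adj x u}) ∧
      (∀ t : M, D'.bag t ⊆ D.bag t) ∧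
      (∀ t : M, Cardinal.mk ↥(D'.bag t) < κ) ∧
      D'.Tight ∧ D'.Componental := by
  exact ⟨D.prune, rfl, fun _ => rfl, fun _ => Set.sdiff_subset,
    fun t => (Cardinal.mk_le_mk_of_subset Set.sdiff_subset).trans_lt (hw t), hcomp.tight_prune,
    hcomp.prune⟩
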